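/- For each E ∈ {A₁₂₃, A₁₄₅, A₁₆₇}, the SO(3)-stabiliser of E equals the subgroup {A ∈ SO(3) : A·(1,0,0)ᵀ = ±(1,0,0)ᵀ}, and this subgroup is isomorphic to the orthogonal group O(2). -/

import Mathlib

noncomputable section

open MvPolynomial Matrix

/-- The polynomial ring `ℝ[x,y,z]`. -/
abbrev P3 := MvPolynomial (Fin 3) ℝ

/-- `SO(3)`, realised as a set of real 3×3 matrices. -/
def SO3 : Set (Matrix (Fin 3) (Fin 3) ℝ) := {A | A * Aᵀ = 1 ∧ A.det = 1}

/-- The substitution action of a matrix `A` on polynomials: `(A · p)(w) = p (A⁻¹ w)`,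
i.e. the variable `Xᵢ` is replaced by `∑ⱼ (A⁻¹)ᵢⱼ Xⱼ`. -/
def sAct (A : Matrix (Fin 3) (Fin 3) ℝ) (p : P3) : P3 :=
  aeval (fun i => ∑ j, A⁻¹ i j • (X j : P3)) p

/-- The Laplace operator on polynomials in three variables. -/
def lap : P3 →ₗ[ℝ] P3 :=
  ∑ i : Fin 3, ((pderiv i).toLinearMap ∘ₗ (pderiv i).toLinearMap)

/-- `H₃`: the space of harmonic homogeneous cubic polynomials in `x, y, z`. -/
def H3 : Submodule ℝ P3 :=
  homogeneousSubmodule (Fin 3) ℝ 3 ⊓ LinearMap.ker lap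

/-- The orthonormal basis `e₁, …, e₇` of `H₃` (with `x = X 0`, `y = X 1`, `z = X 2`). -/
def eH : Fin 7 → P3 :=
  ![(1 / 5 : ℝ) • (X 0 * (2 * X 0 ^ 2 - 3 * X 1 ^ 2 - 3 * X 2 ^ 2)),
    (Real.sqrt 6 / 10) • (X 2 * (4 * X 0 ^ 2 - X 1 ^ 2 - X 2 ^ 2)),
    (Real.sqrt 6 / 10) • (X 1 * (4 * X 0 ^ 2 - X 1 ^ 2 - X 2 ^ 2)),
    (2 * Real.sqrt 15 / 5) • (X 0 * X 1 * X 2),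
    (Real.sqrt 15 / 5) • (X 0 * (X 1 ^ 2 - X 2 ^ 2)),
    (Real.sqrt 10 / 10) • (X 2 * (3 * X 1 ^ 2 - X 2 ^ 2)),
    (Real.sqrt 10 / 10) • (X 1 * (X 1 ^ 2 - 3 * X 2 ^ 2))]

/-- The identification of `ℝ⁷` (coordinates) with `H₃`, via the basis `e₁, …, e₇`. -/
def iotaH (v : Fin 7 → ℝ) : P3 := ∑ i, v i • eH i

/-- The subset of `H₃` corresponding to a coordinate subspace `E ⊆ ℝ⁷`. -/
def polySet (E : Submodule ℝ (Fin 7 → ℝ)) : Set P3 := iotaH '' (E : Set (Fin 7 → ℝ))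

/-- The inner product of `H₃` making `e₁, …, e₇` orthonormal, in coordinates. -/
def dot7 (u v : Fin 7 → ℝ) : ℝ := ∑ i, u i * v i

/-- The 3×3 minor determinant `(eⁱ ∧ eʲ ∧ eᵏ) (u, v, w)`. -/
def triD (u v w : Fin 7 → ℝ) (i j k : Fin 7) : ℝ :=
  Matrix.det !![u i, u j, u k; v i, v j, v k; w i, w j, w k]

/-- The 3-form `φ₀ = e¹²³ + e¹⁴⁵ − e¹⁶⁷ + e²⁴⁶ + e²⁵⁷ + e³⁴⁷ − e³⁵⁶`, in coordinates
(indices shifted by one: `eᵢ = e (i-1)`). -/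
def phi0 (u v w : Fin 7 → ℝ) : ℝ :=
  triD u v w 0 1 2 + triD u v w 0 3 4 - triD u v w 0 5 6 + triD u v w 1 3 5 +
    triD u v w 1 4 6 + triD u v w 2 3 6 - triD u v w 2 4 5

/-- A 3-dimensional subspace `E` of `H₃` (in coordinates) is associative if it has an
orthonormal basis `(u, v, w)` with `φ₀ (u, v, w) = ±1`. -/
def IsAssocSubspace (E : Submodule ℝ (Fin 7 → ℝ)) : Prop :=
  ∃ u v w : Fin 7 → ℝ, u ∈ E ∧ v ∈ E ∧ w ∈ E ∧
    dot7 u u = 1 ∧ dot7 v v = 1 ∧ dot7 w w = 1 ∧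
    dot7 u v = 0 ∧ dot7 u w = 0 ∧ dot7 v w = 0 ∧
    Submodule.span ℝ {u, v, w} = E ∧ (phi0 u v w = 1 ∨ phi0 u v w = -1)

/-- The subspace `E ⊆ H₃` is invariant under the substitution action of `A`: `A · E = E`. -/
def InvUnder (A : Matrix (Fin 3) (Fin 3) ℝ) (E : Submodule ℝ (Fin 7 → ℝ)) : Prop :=
  sAct A '' polySet E = polySet E

/-- The `SO(3)`-stabiliser of a subspace `E ⊆ H₃`: `{A ∈ SO(3) | A · E = E}`. -/
def stabSO3 (E : Submodule ℝ (Fin 7 → ℝ)) : Set (Matrix (Fin 3) (Fin 3) ℝ) :=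
  {A | A ∈ SO3 ∧ InvUnder A E}

/-- The subset `S` of a monoid is a subgroup isomorphic to the group `G`. -/
def SetIsoGroup {M : Type*} [Monoid M] (S : Set M) (G : Type*) [Group G] : Prop :=
  ∃ f : G → M, Function.Injective f ∧ (∀ a b, f (a * b) = f a * f b) ∧ Set.range f = S

/-- The rotation `R_α` about the x-axis through the angle `α`. -/
def Rmat (α : ℝ) : Matrix (Fin 3) (Fin 3) ℝ :=
  !![1, 0, 0; 0, Real.cos α, -Real.sin α; 0, Real.sin α, Real.cos α]

/-- `A₁₂₃ = span (e₁, e₂, e₃)`, in coordinates. -/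
def A123 : Submodule ℝ (Fin 7 → ℝ) :=
  Submodule.span ℝ {![1, 0, 0, 0, 0, 0, 0], ![0, 1, 0, 0, 0, 0, 0], ![0, 0, 1, 0, 0, 0, 0]}

/-- `A₁₄₅ = span (e₁, e₄, e₅)`, in coordinates. -/
def A145 : Submodule ℝ (Fin 7 → ℝ) :=
  Submodule.span ℝ {![1, 0, 0, 0, 0, 0, 0], ![0, 0, 0, 1, 0, 0, 0], ![0, 0, 0, 0, 1, 0, 0]}

/-- `A₁₆₇ = span (e₁, e₆, e₇)`, in coordinates. -/
def A167 : Submodule ℝ (Fin 7 → ℝ) :=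
  Submodule.span ℝ {![1, 0, 0, 0, 0, 0, 0], ![0, 0, 0, 0, 0, 1, 0], ![0, 0, 0, 0, 0, 0, 1]}

/-- The subgroup of `SO(3)` consisting of the matrices with `A·(1,0,0)ᵀ = ±(1,0,0)ᵀ`. -/
def O2fix : Set (Matrix (Fin 3) (Fin 3) ℝ) :=
  {A | A ∈ SO3 ∧ (A.mulVec ![1, 0, 0] = ![1, 0, 0] ∨ A.mulVec ![1, 0, 0] = -![1, 0, 0])}

lemma eval_sAct (A : Matrix (Fin 3) (Fin 3) ℝ) (p : P3) (w : Fin 3 → ℝ) :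
    eval w (sAct A p) = eval (A⁻¹ *ᵥ w) p := by
  have h : (aeval w).comp (aeval (fun i => ∑ j, A⁻¹ i j • (X j : P3))) =
      (aeval (A⁻¹ *ᵥ w) : P3 →ₐ[ℝ] ℝ) := by
    ext i
    simp [mulVec, dotProduct]
  simpa [sAct] using DFunLike.congr_fun h p

lemma sAct_sAct_inv {A : Matrix (Fin 3) (Fin 3) ℝ} (hA : IsUnit A.det) (p : P3) :
    sAct A (sAct A⁻¹ p) = p := by
  refine MvPolynomial.funext fun w => ?_
  rw [eval_sAct, eval_sAct, nonsing_inv_nonsing_inv A hA, mulVec_mulVec, mul_nonsing_inv A hA,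
    one_mulVec]

lemma eval_iotaH (v : Fin 7 → ℝ) (w : Fin 3 → ℝ) :
    eval w (iotaH v) =
      v 0 * (1 / 5 * (w 0 * (2 * w 0 ^ 2 - 3 * w 1 ^ 2 - 3 * w 2 ^ 2))) +
      v 1 * (√6 / 10 * (w 2 * (4 * w 0 ^ 2 - w 1 ^ 2 - w 2 ^ 2))) +
      v 2 * (√6 / 10 * (w 1 * (4 * w 0 ^ 2 - w 1 ^ 2 - w 2 ^ 2))) +
      v 3 * (2 * √15 / 5 * (w 0 * w 1 * w 2)) +
      v 4 * (√15 / 5 * (w 0 * (w 1 ^ 2 - w 2 ^ 2))) +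
      v 5 * (√10 / 10 * (w 2 * (3 * w 1 ^ 2 - w 2 ^ 2))) +
      v 6 * (√10 / 10 * (w 1 * (w 1 ^ 2 - 3 * w 2 ^ 2))) := by
  simp [iotaH, eH, Fin.sum_univ_succ, smul_eval]
  ring

lemma iotaH_injective : Function.Injective iotaH := by
  intro u v huv
  have key (x y z : ℝ) := congrArg (eval ![x, y, z]) huv
  simp only [eval_iotaH, cons_val] at key
  have h6 : √6 ≠ 0 := by positivity
  have h10 : √10 ≠ 0 := by positivity
  have h15 : √15 ≠ 0 := by positivity
  have k1 := key 1 0 0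
  have k2 := key 0 1 0
  have k3 := key 0 0 1
  have k4 := key 1 1 0
  have k5 := key 1 0 1
  have k6 := key 1 1 1
  have e0 : u 0 = v 0 := by linarith
  have e1 : √6 * u 1 = √6 * v 1 := by linarith [key 1 0 (-1)]
  have e2 : √6 * u 2 = √6 * v 2 := by linarith [key 1 (-1) 0]
  have e4 : √15 * u 4 = √15 * v 4 := by linarith [key 1 (-1) 0]
  have e5 : √10 * u 5 = √10 * v 5 := by linarith
  have e6 : √10 * u 6 = √10 * v 6 := by linarith
  have e3 : √15 * u 3 = √15 * v 3 := by linarith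
  ext i
  fin_cases i
  · exact e0
  · exact mul_left_cancel₀ h6 e1
  · exact mul_left_cancel₀ h6 e2
  · exact mul_left_cancel₀ h15 e3
  · exact mul_left_cancel₀ h15 e4
  · exact mul_left_cancel₀ h10 e5
  · exact mul_left_cancel₀ h10 e6

lemma mem_A123 {v : Fin 7 → ℝ} : v ∈ A123 ↔ v 3 = 0 ∧ v 4 = 0 ∧ v 5 = 0 ∧ v 6 = 0 := by
  simp only [A123, Submodule.mem_span_triple, funext_iff, Fin.forall_fin_succ]
  simp [eq_comm]

lemma mem_A145 {v : Fin 7 → ℝ} : v ∈ A145 ↔ v 1 = 0 ∧ v 2 = 0 ∧ v 5 = 0 ∧ v 6 = 0 := by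
  simp only [A145, Submodule.mem_span_triple, funext_iff, Fin.forall_fin_succ]
  simp [eq_comm]

lemma mem_A167 {v : Fin 7 → ℝ} : v ∈ A167 ↔ v 1 = 0 ∧ v 2 = 0 ∧ v 3 = 0 ∧ v 4 = 0 := by
  simp only [A167, Submodule.mem_span_triple, funext_iff, Fin.forall_fin_succ]
  simp [eq_comm]

/-- The block matrix with blocks `ε` and the orthogonal matrix with first column `(a, b)` and
determinant `ε`. -/
def axialMat (ε a b : ℝ) : Matrix (Fin 3) (Fin 3) ℝ :=
  !![ε, 0, 0; 0, a, -ε * b; 0, b, ε * a]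

lemma inv_eq_transpose {A : Matrix (Fin 3) (Fin 3) ℝ} (hA : A ∈ SO3) : A⁻¹ = Aᵀ :=
  inv_eq_right_inv hA.1

lemma isUnit_det_of_mem_SO3 {A : Matrix (Fin 3) (Fin 3) ℝ} (hA : A ∈ SO3) : IsUnit A.det := by
  simp [hA.2]

lemma sq_sum_first_col {A : Matrix (Fin 3) (Fin 3) ℝ} (hA : A ∈ SO3) :
    A 0 0 ^ 2 + A 1 0 ^ 2 + A 2 0 ^ 2 = 1 := by
  have hT : Aᵀ * A = 1 := mul_eq_one_comm.mp hA.1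
  have h := congrFun (congrFun hT 0) 0
  simp only [mul_apply, transpose_apply, Fin.sum_univ_three, one_apply_eq] at h
  linear_combination h

lemma mulVec_e1 (A : Matrix (Fin 3) (Fin 3) ℝ) :
    A *ᵥ ![1, 0, 0] = ![A 0 0, A 1 0, A 2 0] := by
  ext i
  fin_cases i <;> simp [mulVec, dotProduct, Fin.sum_univ_succ]

lemma axialMat_mem_O2fix {ε a b : ℝ} (hε : ε = 1 ∨ ε = -1) (hab : a ^ 2 + b ^ 2 = 1) :
    axialMat ε a b ∈ O2fix := by
  refine ⟨⟨?_, ?_⟩, ?_⟩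
  · ext i j
    fin_cases i <;> fin_cases j <;> rcases hε with rfl | rfl <;>
      simp [axialMat, mul_apply, Fin.sum_univ_succ] <;> linarith
  · rcases hε with rfl | rfl <;> simp [axialMat, det_fin_three] <;> linarith
  · rw [mulVec_e1]
    rcases hε with rfl | rfl <;> simp [axialMat]

lemma exists_eq_axialMat {A : Matrix (Fin 3) (Fin 3) ℝ} (hA : A ∈ O2fix) :
    ∃ ε a b : ℝ, (ε = 1 ∨ ε = -1) ∧ a ^ 2 + b ^ 2 = 1 ∧ A = axialMat ε a b := by
  obtain ⟨⟨horth, hdet⟩, hfix⟩ := hA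
  have hcol : (A 0 0 = 1 ∨ A 0 0 = -1) ∧ A 1 0 = 0 ∧ A 2 0 = 0 := by
    rw [mulVec_e1] at hfix
    rcases hfix with h | h
    · have h0 := congrFun h 0
      have h1 := congrFun h 1
      have h2 := congrFun h 2
      simp at h0 h1 h2
      exact ⟨.inl h0, h1, h2⟩
    · have h0 := congrFun h 0
      have h1 := congrFun h 1
      have h2 := congrFun h 2
      simp at h0 h1 h2
      exact ⟨.inr h0, h1, h2⟩
  obtain ⟨hε, h10, h20⟩ := hcol
  have hT : Aᵀ * A = 1 := mul_eq_one_comm.mp horth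
  have key (i j : Fin 3) := congrFun (congrFun hT i) j
  have k01 := key 0 1
  have k02 := key 0 2
  have k11 := key 1 1
  have k12 := key 1 2
  simp [mul_apply, Fin.sum_univ_succ, h10, h20] at k01 k02 k11 k12
  have hne : A 0 0 ≠ 0 := by rcases hε with h | h <;> simp [h]
  have h01 : A 0 1 = 0 := k01.resolve_left hne
  have h02 : A 0 2 = 0 := k02.resolve_left hne
  have hsq : A 0 0 * A 0 0 = 1 := by rcases hε with h | h <;> simp [h]
  rw [det_fin_three] at hdet
  simp only [h10, h20, h01, h02] at hdet k11 k12
  have h22 : A 2 2 = A 0 0 * A 1 1 := by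
    linear_combination (-A 2 2) * k11 + A 2 1 * k12 + A 0 0 * A 1 1 * hdet
      - A 1 1 * (A 1 1 * A 2 2 - A 1 2 * A 2 1) * hsq
  have h12 : A 1 2 = -A 0 0 * A 2 1 := by
    linear_combination (-A 1 2) * k11 + A 1 1 * k12 - A 0 0 * A 2 1 * hdet
      + A 2 1 * (A 1 1 * A 2 2 - A 1 2 * A 2 1) * hsq
  refine ⟨A 0 0, A 1 1, A 2 1, hε, by linear_combination k11, ?_⟩
  ext i j
  fin_cases i <;> fin_cases j <;> simp [axialMat, h10, h20, h01, h02, h12, h22]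

lemma inv_mem_O2fix {A : Matrix (Fin 3) (Fin 3) ℝ} (hA : A ∈ O2fix) : A⁻¹ ∈ O2fix := by
  rw [inv_eq_transpose hA.1]
  obtain ⟨ε, a, b, hε, hab, rfl⟩ := exists_eq_axialMat hA
  have h : (axialMat ε a b)ᵀ = axialMat ε a (-ε * b) := by
    ext i j
    fin_cases i <;> fin_cases j <;> rcases hε with rfl | rfl <;> simp [axialMat]
  rw [h]
  exact axialMat_mem_O2fix hε (by rcases hε with rfl | rfl <;> linarith)

/-- In the coordinates `e₁, …, e₇`, `axialMat ε a b` acts on the planes `⟨e₂, e₃⟩`, `⟨e₄, e₅⟩`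
and `⟨e₆, e₇⟩` by the first, second and third powers of `a + b i`, up to reflections. -/
lemma sAct_axialMat_iotaH {ε a b : ℝ} (hε : ε = 1 ∨ ε = -1) (hab : a ^ 2 + b ^ 2 = 1)
    (v : Fin 7 → ℝ) :
    sAct (axialMat ε a b) (iotaH v) = iotaH ![ε * v 0,
      ε * a * v 1 + b * v 2, -ε * b * v 1 + a * v 2,
      (a ^ 2 - b ^ 2) * v 3 + ε * (2 * a * b) * v 4,
      -(2 * a * b) * v 3 + ε * (a ^ 2 - b ^ 2) * v 4,
      ε * (a ^ 3 - 3 * a * b ^ 2) * v 5 + (3 * a ^ 2 * b - b ^ 3) * v 6,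
      -ε * (3 * a ^ 2 * b - b ^ 3) * v 5 + (a ^ 3 - 3 * a * b ^ 2) * v 6] := by
  refine MvPolynomial.funext fun w => ?_
  rw [eval_sAct, inv_eq_transpose (axialMat_mem_O2fix hε hab).1, eval_iotaH, eval_iotaH]
  have h0 : ((axialMat ε a b)ᵀ *ᵥ w) 0 = ε * w 0 := by
    simp [axialMat, mulVec, dotProduct, Fin.sum_univ_succ]
  have h1 : ((axialMat ε a b)ᵀ *ᵥ w) 1 = a * w 1 + b * w 2 := by
    simp [axialMat, mulVec, dotProduct, Fin.sum_univ_succ]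
  have h2 : ((axialMat ε a b)ᵀ *ᵥ w) 2 = ε * (a * w 2 - b * w 1) := by
    simp [axialMat, mulVec, dotProduct, Fin.sum_univ_succ]
    ring
  rw [h0, h1, h2]
  simp only [cons_val]
  rcases hε with rfl | rfl
  · linear_combination (-(w 1 ^ 2 + w 2 ^ 2)) * (3 / 5 * v 0 * w 0 +
      √6 / 10 * (v 1 * (a * w 2 - b * w 1) + v 2 * (a * w 1 + b * w 2))) * hab
  · linear_combination (-(w 1 ^ 2 + w 2 ^ 2)) * (-(3 / 5) * v 0 * w 0 +
      √6 / 10 * (-(v 1 * (a * w 2 - b * w 1)) + v 2 * (a * w 1 + b * w 2))) * hab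

lemma iotaH_mem_polySet {E : Submodule ℝ (Fin 7 → ℝ)} {v : Fin 7 → ℝ} :
    iotaH v ∈ polySet E ↔ v ∈ E :=
  iotaH_injective.mem_set_image

/-- The zonal harmonic with axis the image of `e₁`, expanded in the basis by the reproducing
property. -/
lemma sAct_zonal {A : Matrix (Fin 3) (Fin 3) ℝ} (hA : A ∈ SO3) :
    sAct A (iotaH (Pi.single 0 1)) =
      iotaH (fun i => 5 / 2 * eval (fun j => A j 0) (eH i)) := by
  refine MvPolynomial.funext fun w => ?_
  rw [eval_sAct, inv_eq_transpose hA, eval_iotaH, eval_iotaH]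
  have hn := sq_sum_first_col hA
  have hw : (Aᵀ *ᵥ w) 0 ^ 2 + (Aᵀ *ᵥ w) 1 ^ 2 + (Aᵀ *ᵥ w) 2 ^ 2 =
      w 0 ^ 2 + w 1 ^ 2 + w 2 ^ 2 := by
    have h : (Aᵀ *ᵥ w) ⬝ᵥ (Aᵀ *ᵥ w) = w ⬝ᵥ w := by
      rw [dotProduct_mulVec, vecMul_transpose, mulVec_mulVec, hA.1, one_mulVec]
    simp only [dotProduct, Fin.sum_univ_three] at h
    linear_combination h
  have h0 : (Aᵀ *ᵥ w) 0 = A 0 0 * w 0 + A 1 0 * w 1 + A 2 0 * w 2 := by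
    simp [mulVec, dotProduct, Fin.sum_univ_three]
  have h6 : √6 ^ 2 = 6 := Real.sq_sqrt (by norm_num)
  have h10 : √10 ^ 2 = 10 := Real.sq_sqrt (by norm_num)
  have h15 : √15 ^ 2 = 15 := Real.sq_sqrt (by norm_num)
  have hl : (1 : ℝ) / 5 * ((Aᵀ *ᵥ w) 0 * (2 * (Aᵀ *ᵥ w) 0 ^ 2 - 3 * (Aᵀ *ᵥ w) 1 ^ 2
      - 3 * (Aᵀ *ᵥ w) 2 ^ 2)) = (A 0 0 * w 0 + A 1 0 * w 1 + A 2 0 * w 2) ^ 3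
      - 3 / 5 * (A 0 0 ^ 2 + A 1 0 ^ 2 + A 2 0 ^ 2) * (w 0 ^ 2 + w 1 ^ 2 + w 2 ^ 2) *
        (A 0 0 * w 0 + A 1 0 * w 1 + A 2 0 * w 2) := by
    rw [← h0, hn]
    linear_combination (-3 / 5) * (Aᵀ *ᵥ w) 0 * hw
  simp only [Pi.single_apply]
  simp [eH, smul_eval] at hl ⊢
  rw [hl]
  generalize A 0 0 = a, A 1 0 = b, A 2 0 = c, w 0 = x, w 1 = y, w 2 = z
  ring_nf
  rw [h6, h10, h15]
  ring

lemma mem_O2fix_of_apply_eq_zero {A : Matrix (Fin 3) (Fin 3) ℝ} (hA : A ∈ SO3)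
    (h1 : A 1 0 = 0) (h2 : A 2 0 = 0) : A ∈ O2fix := by
  refine ⟨hA, ?_⟩
  have h := sq_sum_first_col hA
  simp [h1, h2] at h
  rw [mulVec_e1, h1, h2]
  rcases h with h | h <;> simp [h]

lemma stabSO3_eq_O2fix {E : Submodule ℝ (Fin 7 → ℝ)} (he1 : Pi.single 0 1 ∈ E)
    (hE : ∀ A ∈ O2fix, ∀ v ∈ E, sAct A (iotaH v) ∈ polySet E)
    (hfix : ∀ n : Fin 3 → ℝ, (fun i => 5 / 2 * eval n (eH i)) ∈ E → n 1 = 0 ∧ n 2 = 0) :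
    stabSO3 E = O2fix := by
  ext A
  constructor
  · rintro ⟨hA, hinv⟩
    have h : sAct A (iotaH (Pi.single 0 1)) ∈ polySet E := by
      rw [← (hinv : _ = _)]
      exact Set.mem_image_of_mem _ (Set.mem_image_of_mem _ he1)
    rw [sAct_zonal hA, iotaH_mem_polySet] at h
    obtain ⟨h1, h2⟩ := hfix _ h
    exact mem_O2fix_of_apply_eq_zero hA h1 h2
  · intro hA
    refine ⟨hA.1, Set.Subset.antisymm ?_ ?_⟩
    · rintro _ ⟨_, ⟨v, hv, rfl⟩, rfl⟩
      exact hE A hA v hv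
    · rintro _ ⟨v, hv, rfl⟩
      exact ⟨_, hE _ (inv_mem_O2fix hA) v hv, sAct_sAct_inv (isUnit_det_of_mem_SO3 hA.1) _⟩

lemma eq_zero_of_cubic_eq_zero {y z : ℝ} (h6 : z * (3 * y ^ 2 - z ^ 2) = 0)
    (h7 : y * (y ^ 2 - 3 * z ^ 2) = 0) : y = 0 ∧ z = 0 := by
  have h : (y ^ 2 + z ^ 2) ^ 3 = 0 := by
    linear_combination z * (3 * y ^ 2 - z ^ 2) * h6 + y * (y ^ 2 - 3 * z ^ 2) * h7
  have h := pow_eq_zero_iff (by norm_num) |>.mp h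
  constructor <;> nlinarith [sq_nonneg y, sq_nonneg z]

lemma stabSO3_A123 : stabSO3 A123 = O2fix := by
  refine stabSO3_eq_O2fix (by simp [mem_A123]) ?_ ?_
  · intro A hA v hv
    obtain ⟨ε, a, b, hε, hab, rfl⟩ := exists_eq_axialMat hA
    obtain ⟨h3, h4, h5, h6⟩ := mem_A123.mp hv
    rw [sAct_axialMat_iotaH hε hab, iotaH_mem_polySet, mem_A123]
    simp [h3, h4, h5, h6]
  · intro n hn
    obtain ⟨-, -, h6, h7⟩ := mem_A123.mp hn
    simp [eH, smul_eval] at h6 h7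
    exact eq_zero_of_cubic_eq_zero (by simpa using h6) (by simpa using h7)

lemma stabSO3_A145 : stabSO3 A145 = O2fix := by
  refine stabSO3_eq_O2fix (by simp [mem_A145]) ?_ ?_
  · intro A hA v hv
    obtain ⟨ε, a, b, hε, hab, rfl⟩ := exists_eq_axialMat hA
    obtain ⟨h1, h2, h5, h6⟩ := mem_A145.mp hv
    rw [sAct_axialMat_iotaH hε hab, iotaH_mem_polySet, mem_A145]
    simp [h1, h2, h5, h6]
  · intro n hn
    obtain ⟨-, -, h6, h7⟩ := mem_A145.mp hn
    simp [eH, smul_eval] at h6 h7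
    exact eq_zero_of_cubic_eq_zero (by simpa using h6) (by simpa using h7)

lemma stabSO3_A167 : stabSO3 A167 = O2fix := by
  refine stabSO3_eq_O2fix (by simp [mem_A167]) ?_ ?_
  · intro A hA v hv
    obtain ⟨ε, a, b, hε, hab, rfl⟩ := exists_eq_axialMat hA
    obtain ⟨h1, h2, h3, h4⟩ := mem_A167.mp hv
    rw [sAct_axialMat_iotaH hε hab, iotaH_mem_polySet, mem_A167]
    simp [h1, h2, h3, h4]
  · intro n hn
    obtain ⟨h2, h3, h4, h5⟩ := mem_A167.mp hn
    have e2 : n 2 * (4 * n 0 ^ 2 - n 1 ^ 2 - n 2 ^ 2) = 0 := by simpa [eH, smul_eval] using h2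
    have e3 : n 1 * (4 * n 0 ^ 2 - n 1 ^ 2 - n 2 ^ 2) = 0 := by simpa [eH, smul_eval] using h3
    have e4 : n 0 * n 1 * n 2 = 0 := by simpa [eH, smul_eval] using h4
    have e5 : n 0 * (n 1 ^ 2 - n 2 ^ 2) = 0 := by simpa [eH, smul_eval] using h5
    have hx : n 0 * (n 1 ^ 2 + n 2 ^ 2) = 0 := by
      refine pow_eq_zero_iff two_ne_zero |>.mp ?_
      linear_combination n 0 * (n 1 ^ 2 - n 2 ^ 2) * e5 + 4 * n 0 * n 1 * n 2 * e4
    have hr : n 1 ^ 2 + n 2 ^ 2 = 0 := by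
      refine pow_eq_zero_iff two_ne_zero |>.mp ?_
      linear_combination 4 * n 0 * hx - n 1 * e3 - n 2 * e2
    constructor <;> nlinarith [sq_nonneg (n 1), sq_nonneg (n 2)]

lemma setIsoGroup_O2fix : SetIsoGroup O2fix ↥(orthogonalGroup (Fin 2) ℝ) := by
  refine ⟨fun B => !![B.val.det, 0, 0; 0, B.val 0 0, B.val 0 1; 0, B.val 1 0, B.val 1 1], ?_, ?_, ?_⟩
  · intro B C h
    have key (i j : Fin 3) := congrFun (congrFun h i) j
    have k11 := key 1 1
    have k12 := key 1 2
    have k21 := key 2 1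
    have k22 := key 2 2
    simp at k11 k12 k21 k22
    ext i j
    fin_cases i <;> fin_cases j <;> assumption
  · intro B C
    ext i j
    fin_cases i <;> fin_cases j <;>
      simp [mul_apply, Fin.sum_univ_succ, det_mul]
  · ext A
    constructor
    · rintro ⟨⟨B, hB⟩, rfl⟩
      have hBB : B * Bᵀ = 1 := (mem_orthogonalGroup_iff (Fin 2) ℝ).mp hB
      have hdet : B.det * B.det = 1 := by
        simpa [det_mul] using congrArg det hBB
      have key (i j : Fin 2) := congrFun (congrFun hBB i) j
      have k00 := key 0 0
      have k01 := key 0 1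
      have k11 := key 1 1
      simp [mul_apply, Fin.sum_univ_succ] at k00 k01 k11
      refine ⟨⟨?_, ?_⟩, ?_⟩
      · ext i j
        fin_cases i <;> fin_cases j <;>
          simp [mul_apply, Fin.sum_univ_succ, hdet] <;> linarith
      · rw [det_fin_two] at hdet
        simp [det_fin_three, det_fin_two]
        linear_combination hdet
      · rw [mulVec_e1]
        rcases mul_self_eq_one_iff.mp hdet with h | h <;> simp [h]
    · intro hA
      obtain ⟨ε, a, b, hε, hab, rfl⟩ := exists_eq_axialMat hA
      refine ⟨⟨!![a, -ε * b; b, ε * a], ?_⟩, ?_⟩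
      · rw [mem_orthogonalGroup_iff]
        ext i j
        fin_cases i <;> fin_cases j <;> rcases hε with rfl | rfl <;>
          simp [mul_apply, Fin.sum_univ_succ] <;> linarith
      · ext i j
        fin_cases i <;> fin_cases j <;> simp [axialMat, det_fin_two]
        linear_combination ε * hab

/-- For each `E ∈ {A₁₂₃, A₁₄₅, A₁₆₇}`, the `SO(3)`-stabiliser of `E` equals
`{A ∈ SO(3) : A·(1,0,0)ᵀ = ±(1,0,0)ᵀ}`, and this subgroup is isomorphic to `O(2)`. -/
theorem stmt2 :
    stabSO3 A123 = O2fix ∧ stabSO3 A145 = O2fix ∧ stabSO3 A167 = O2fix ∧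
    SetIsoGroup O2fix ↥(Matrix.orthogonalGroup (Fin 2) ℝ) := by
  exact ⟨stabSO3_A123, stabSO3_A145, stabSO3_A167, setIsoGroup_O2fix⟩
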